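/- Let n ≥ 2, E a nonempty finite set of ordered pairs (i,j) with i ≠ j, weights λ_{ij} ≥ 0, and Λ = Σ_{(i,j)∈E} λ_{ij}(e_i−e_j)(e_i−e_j)ᵀ, and assume the kernel of Λ is exactly the span of 𝟙. Suppose there exists c > 0 such that λ_{ij} ≥ c·Tr(Λ)/(2|E|) for every (i,j) ∈ E. Then c ≤ 1, and χ₂[Λ] ≤ (n−1)|E|/(c·Tr(Λ)), where χ₂[Λ] = (1/2)·sup_{(i,j)∈E}(e_i−e_j)ᵀΛ⁺(e_i−e_j). (The value c = 1 corresponds to uniform edge weights.) -/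

import Mathlib

open Matrix BigOperators

noncomputable section

/-- The vector `e_i - e_j` in `ℝⁿ`. -/
def gVec (n : ℕ) (i j : Fin n) : Fin n → ℝ :=
  fun k => (if k = i then (1 : ℝ) else 0) - (if k = j then (1 : ℝ) else 0)

/-- The expected gossip matrix `Λ = Σ_{(i,j)∈E} λ_{ij} (e_i-e_j)(e_i-e_j)ᵀ`. -/
def gMat (n : ℕ) (E : Finset (Fin n × Fin n)) (lam : Fin n × Fin n → ℝ) :
    Matrix (Fin n) (Fin n) ℝ :=
  ∑ p ∈ E, lam p • Matrix.vecMulVec (gVec n p.1 p.2) (gVec n p.1 p.2)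

/-- `B` is the Moore–Penrose pseudoinverse of `A`. -/
def IsMPInv {n : ℕ} (A B : Matrix (Fin n) (Fin n) ℝ) : Prop :=
  A * B * A = A ∧ B * A * B = B ∧ (A * B)ᵀ = A * B ∧ (B * A)ᵀ = B * A

/-- `χ₂[Λ] = (1/2)·sup_{(i,j)∈E} (e_i-e_j)ᵀ Λ⁺ (e_i-e_j)`, expressed in terms of the
pseudoinverse `Λp` of `Λ`. -/
def chi2 (n : ℕ) (E : Finset (Fin n × Fin n)) (Λp : Matrix (Fin n) (Fin n) ℝ) : ℝ :=
  (1 / 2) * sSup {r : ℝ | ∃ p ∈ E, r = gVec n p.1 p.2 ⬝ᵥ (Λp *ᵥ gVec n p.1 p.2)}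

theorem gMat_mulVec (n : ℕ) (E : Finset (Fin n × Fin n)) (lam : Fin n × Fin n → ℝ)
    (x : Fin n → ℝ) :
    gMat n E lam *ᵥ x = ∑ p ∈ E, (lam p * (gVec n p.1 p.2 ⬝ᵥ x)) • gVec n p.1 p.2 := by
  simp only [gMat, Matrix.sum_mulVec, Matrix.smul_mulVec, Matrix.vecMulVec_mulVec]
  refine Finset.sum_congr rfl fun p _ => ?_
  ext k
  simp [mul_comm, mul_left_comm]

theorem gMat_transpose (n : ℕ) (E : Finset (Fin n × Fin n)) (lam : Fin n × Fin n → ℝ) :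
    (gMat n E lam)ᵀ = gMat n E lam := by
  simp [gMat, Matrix.transpose_sum, Matrix.transpose_smul, Matrix.transpose_vecMulVec]

theorem dotProduct_gMat_mulVec_nonneg (n : ℕ) (E : Finset (Fin n × Fin n))
    (lam : Fin n × Fin n → ℝ) (hlam : ∀ p ∈ E, 0 ≤ lam p) (x : Fin n → ℝ) :
    0 ≤ x ⬝ᵥ (gMat n E lam *ᵥ x) := by
  rw [gMat_mulVec, dotProduct_sum]
  refine Finset.sum_nonneg fun p hp => ?_
  rw [dotProduct_smul, dotProduct_comm x, smul_eq_mul, mul_assoc]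
  exact mul_nonneg (hlam p hp) (mul_self_nonneg _)

theorem trace_mul_gMat (n : ℕ) (E : Finset (Fin n × Fin n)) (lam : Fin n × Fin n → ℝ)
    (B : Matrix (Fin n) (Fin n) ℝ) :
    (B * gMat n E lam).trace =
      ∑ p ∈ E, lam p * (gVec n p.1 p.2 ⬝ᵥ (B *ᵥ gVec n p.1 p.2)) := by
  simp only [gMat, Matrix.mul_sum, Matrix.trace_sum, Matrix.mul_smul, Matrix.trace_smul,
    Matrix.mul_vecMulVec, Matrix.trace_vecMulVec, smul_eq_mul]
  exact Finset.sum_congr rfl fun p _ => by rw [dotProduct_comm]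

theorem gVec_dotProduct (n : ℕ) (i j : Fin n) (x : Fin n → ℝ) :
    gVec n i j ⬝ᵥ x = x i - x j := by
  simp [gVec, dotProduct, sub_mul, Finset.sum_sub_distrib]

theorem gVec_dotProduct_self (n : ℕ) {i j : Fin n} (h : i ≠ j) :
    gVec n i j ⬝ᵥ gVec n i j = 2 := by
  rw [gVec_dotProduct]
  simp [gVec, h, h.symm]
  norm_num

theorem trace_gMat (n : ℕ) (E : Finset (Fin n × Fin n)) (hE : ∀ p ∈ E, p.1 ≠ p.2)
    (lam : Fin n × Fin n → ℝ) : (gMat n E lam).trace = 2 * ∑ p ∈ E, lam p := by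
  have h := trace_mul_gMat n E lam 1
  rw [Matrix.one_mul] at h
  rw [h, Finset.mul_sum]
  refine Finset.sum_congr rfl fun p hp => ?_
  rw [Matrix.one_mulVec, gVec_dotProduct_self n (hE p hp), mul_comm]

theorem trace_gMat_pos (n : ℕ) (hn : 2 ≤ n) (E : Finset (Fin n × Fin n))
    (hE : ∀ p ∈ E, p.1 ≠ p.2) (lam : Fin n × Fin n → ℝ) (hlam : ∀ p ∈ E, 0 ≤ lam p)
    (hker : ∀ x : Fin n → ℝ, gMat n E lam *ᵥ x = 0 ↔ ∃ c : ℝ, x = fun _ => c) :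
    0 < (gMat n E lam).trace := by
  rw [trace_gMat n E hE]
  refine mul_pos two_pos ((Finset.sum_nonneg hlam).lt_of_ne' fun h0 => ?_)
  have hz := (Finset.sum_eq_zero_iff_of_nonneg hlam).1 h0
  have hx : gMat n E lam *ᵥ (fun k : Fin n => (k : ℝ)) = 0 := by
    rw [gMat_mulVec]
    exact Finset.sum_eq_zero fun p hp => by simp [hz p hp]
  obtain ⟨d, hd⟩ := (hker _).1 hx
  have h1 := congrFun hd ⟨0, by omega⟩
  have h2 := congrFun hd ⟨1, by omega⟩
  simp at h1 h2
  linarith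

/-- If the kernel of `A` is spanned by the all-ones vector, then `A⁺ A = I - 𝟙𝟙ᵀ / n`. -/
theorem IsMPInv.mul_eq_of_ker {n : ℕ} {A B : Matrix (Fin n) (Fin n) ℝ} (h : IsMPInv A B)
    (hker : ∀ x : Fin n → ℝ, A *ᵥ x = 0 ↔ ∃ c : ℝ, x = fun _ => c) (i j : Fin n) :
    (B * A) i j = (if i = j then 1 else 0) - 1 / (n : ℝ) := by
  have hconst : ∀ i i' j, (1 - B * A) i j = (1 - B * A) i' j := by
    intro i i' j
    have hz : A *ᵥ (fun k => (1 - B * A) k j) = 0 := by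
      have hm : A * (1 - B * A) = 0 := by
        rw [Matrix.mul_sub, Matrix.mul_one, ← Matrix.mul_assoc, h.1, sub_self]
      ext k
      exact congrFun (congrFun hm k) j
    obtain ⟨d, hd⟩ := (hker _).1 hz
    exact (congrFun hd i).trans (congrFun hd i').symm
  have hsymm : ∀ i j, (1 - B * A) i j = (1 - B * A) j i := by
    intro i j
    have ht : (1 - B * A)ᵀ = 1 - B * A := by
      rw [Matrix.transpose_sub, Matrix.transpose_one, h.2.2.2]
    exact (congrFun (congrFun ht j) i)
  have hall : ∀ k, (1 - B * A) i k = (1 - B * A) i j := fun k => by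
    rw [hsymm i k, hconst k j i, hsymm j i]
  have hone : (1 - B * A) *ᵥ (fun _ => (1 : ℝ)) = fun _ => 1 := by
    rw [Matrix.sub_mulVec, Matrix.one_mulVec, ← Matrix.mulVec_mulVec, (hker _).2 ⟨1, rfl⟩,
      Matrix.mulVec_zero, sub_zero]
  have hs : (n : ℝ) * (1 - B * A) i j = 1 := by
    simpa [Matrix.mulVec, dotProduct, hall, mul_sub] using congrFun hone i
  have hn : (n : ℝ) ≠ 0 := left_ne_zero_of_mul_eq_one hs
  have hv : (1 - B * A) i j = 1 / (n : ℝ) := by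
    field_simp
    linarith
  rw [← hv, Matrix.sub_apply, Matrix.one_apply]
  ring

theorem IsMPInv.trace_mul_of_ker {n : ℕ} {A B : Matrix (Fin n) (Fin n) ℝ} (hn : n ≠ 0)
    (h : IsMPInv A B) (hker : ∀ x : Fin n → ℝ, A *ᵥ x = 0 ↔ ∃ c : ℝ, x = fun _ => c) :
    (B * A).trace = (n : ℝ) - 1 := by
  have hn' : (n : ℝ) ≠ 0 := Nat.cast_ne_zero.2 hn
  simp only [Matrix.trace, Matrix.diag_apply, h.mul_eq_of_ker hker]
  simp [hn']

/-- Effective resistances are nonnegative. -/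
theorem IsMPInv.gVec_dotProduct_mulVec_nonneg {n : ℕ} {A B : Matrix (Fin n) (Fin n) ℝ}
    (h : IsMPInv A B) (hker : ∀ x : Fin n → ℝ, A *ᵥ x = 0 ↔ ∃ c : ℝ, x = fun _ => c)
    (hA : Aᵀ = A) (hpos : ∀ x : Fin n → ℝ, 0 ≤ x ⬝ᵥ (A *ᵥ x)) (i j : Fin n) :
    0 ≤ gVec n i j ⬝ᵥ (B *ᵥ gVec n i j) := by
  set g := gVec n i j
  have hg : (B * A) *ᵥ g = g := by
    ext k
    rw [Matrix.mulVec, dotProduct_comm, gVec_dotProduct, h.mul_eq_of_ker hker,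
      h.mul_eq_of_ker hker]
    simp [g, gVec]
  have hAh : A *ᵥ (Bᵀ *ᵥ g) = g := by
    have ht : A * Bᵀ = B * A := by
      rw [← h.2.2.2, Matrix.transpose_mul, hA]
    rw [Matrix.mulVec_mulVec, ht, hg]
  have key := hpos (Bᵀ *ᵥ g)
  rwa [hAh, dotProduct_comm, Matrix.mulVec_transpose, dotProduct_comm,
    ← Matrix.dotProduct_mulVec] at key

theorem stmt5 (n : ℕ) (hn : 2 ≤ n) (E : Finset (Fin n × Fin n)) (hne : E.Nonempty)
    (hE : ∀ p ∈ E, p.1 ≠ p.2) (lam : Fin n × Fin n → ℝ)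
    (hlam : ∀ p ∈ E, 0 ≤ lam p) (Λp : Matrix (Fin n) (Fin n) ℝ)
    (hker : ∀ x : Fin n → ℝ, gMat n E lam *ᵥ x = 0 ↔ ∃ c : ℝ, x = fun _ => c)
    (hmp : IsMPInv (gMat n E lam) Λp)
    (c : ℝ) (hc : 0 < c)
    (hlow : ∀ p ∈ E, c * (gMat n E lam).trace / (2 * (E.card : ℝ)) ≤ lam p) :
    c ≤ 1 ∧
    chi2 n E Λp ≤ ((n : ℝ) - 1) * (E.card : ℝ) / (c * (gMat n E lam).trace) := by
  have hT := trace_gMat_pos n hn E hE lam hlam hker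
  have hcard : (0 : ℝ) < E.card := Nat.cast_pos.2 hne.card_pos
  have hsum : (gMat n E lam).trace = 2 * ∑ p ∈ E, lam p := trace_gMat n E hE lam
  set T := (gMat n E lam).trace with hTdef
  refine ⟨?_, ?_⟩
  · have h := Finset.card_nsmul_le_sum E lam _ hlow
    rw [nsmul_eq_mul] at h
    have he : (E.card : ℝ) * (c * T / (2 * E.card)) = c * T / 2 := by field_simp
    rw [he] at h
    nlinarith
  · have hR : ∀ p : Fin n × Fin n, 0 ≤ gVec n p.1 p.2 ⬝ᵥ (Λp *ᵥ gVec n p.1 p.2) := fun p =>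
      hmp.gVec_dotProduct_mulVec_nonneg hker (gMat_transpose n E lam)
        (dotProduct_gMat_mulVec_nonneg n E lam hlam) p.1 p.2
    have htr := hmp.trace_mul_of_ker (by omega) hker
    rw [trace_mul_gMat] at htr
    have hbound : sSup {r : ℝ | ∃ p ∈ E, r = gVec n p.1 p.2 ⬝ᵥ (Λp *ᵥ gVec n p.1 p.2)} ≤
        2 * (((n : ℝ) - 1) * E.card / (c * T)) := by
      obtain ⟨p₀, hp₀⟩ := hne
      refine csSup_le ⟨_, p₀, hp₀, rfl⟩ ?_
      rintro r ⟨p, hp, rfl⟩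
      have h1 := Finset.single_le_sum
        (f := fun p => lam p * (gVec n p.1 p.2 ⬝ᵥ (Λp *ᵥ gVec n p.1 p.2)))
        (fun q hq => mul_nonneg (hlam q hq) (hR q)) hp
      have h2 := (mul_le_mul_of_nonneg_right (hlow p hp) (hR p)).trans (h1.trans htr.le)
      rw [div_mul_eq_mul_div, div_le_iff₀ (by positivity)] at h2
      rw [← mul_div_assoc, le_div_iff₀ (by positivity)]
      linarith
    rw [chi2]
    linarith
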